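/- Let Γ be a finite-index subgroup of SL₂(ℤ), let p, q be integers with p + q > 0, and let z, w ∈ ℂ∖ℝ be such that γ·z ∉ {w, conj w} for every γ ∈ Γ. Then for all γ₁, γ₂ ∈ Γ one has Ψ_Γ^{p,q}(γ₁·z, γ₂·w) = j_{γ₁}(z)^{p+q+2}·j_{γ₂}(w)^{p}·j_{γ₂}(conj w)^{q}·Ψ_Γ^{p,q}(z, w) (both sides being defined, since the hypothesis on (z,w) also holds for (γ₁·z, γ₂·w)). -/

import Mathlib

/- STATEMENT 6: Modularity of the Poincaré series `Ψ_Γ^{p,q}(z,w)`: it is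
modular of weight `p+q+2` in `z` and of weights `(p,q)` in `w`. -/

open Complex ComplexConjugate

noncomputable section

abbrev SL2Z := Matrix.SpecialLinearGroup (Fin 2) ℤ

/-- The real matrix associated to an element of `SL₂(ℤ)`. -/
def toRealM (γ : SL2Z) : Matrix (Fin 2) (Fin 2) ℝ :=
  γ.val.map fun n => (n : ℝ)

/-- Automorphy factor `j_γ(z) = c·z + d` for a real matrix `γ = (a, b; c, d)`. -/
def jFac (γ : Matrix (Fin 2) (Fin 2) ℝ) (z : ℂ) : ℂ :=
  ((γ 1 0 : ℝ) : ℂ) * z + ((γ 1 1 : ℝ) : ℂ)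

/-- Möbius action `γ·z = (a·z + b)/(c·z + d)`. -/
def moeb (γ : Matrix (Fin 2) (Fin 2) ℝ) (z : ℂ) : ℂ :=
  (((γ 0 0 : ℝ) : ℂ) * z + ((γ 0 1 : ℝ) : ℂ)) / (((γ 1 0 : ℝ) : ℂ) * z + ((γ 1 1 : ℝ) : ℂ))

/-- `ψ^{p,q}(z,w) = (w − conj w)/((z − w)^(p+1)·(z − conj w)^(q+1))`. -/
def psiPQ (p q : ℤ) (z w : ℂ) : ℂ :=
  (w - conj w) / ((z - w) ^ (p + 1) * (z - conj w) ^ (q + 1))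

/-- The meromorphic Poincaré series `Ψ_Γ^{p,q}(z,w)`. -/
def PsiS (Γ : Subgroup SL2Z) (p q : ℤ) (z w : ℂ) : ℂ :=
  ∑' γ : Γ, jFac (toRealM ↑γ) z ^ (-(p + q + 2)) * psiPQ p q (moeb (toRealM ↑γ) z) w

/-- The entries of an element of `SL₂(ℤ)` satisfy `ad - bc = 1`, read in `ℂ`. -/
lemma toRealM_det (γ : SL2Z) :
    ((toRealM γ 0 0 : ℝ) : ℂ) * ((toRealM γ 1 1 : ℝ) : ℂ)
      - ((toRealM γ 0 1 : ℝ) : ℂ) * ((toRealM γ 1 0 : ℝ) : ℂ) = 1 := by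
  have h := γ.det_coe
  rw [Matrix.det_fin_two] at h
  simp only [toRealM, Matrix.map_apply]
  exact_mod_cast h

lemma toRealM_mul (γ δ : SL2Z) : toRealM (γ * δ) = toRealM γ * toRealM δ := by
  ext i j
  simp [toRealM, Matrix.mul_apply]

lemma jFac_ne_zero (γ : SL2Z) {z : ℂ} (hz : z.im ≠ 0) : jFac (toRealM γ) z ≠ 0 := by
  intro h
  have hdet := toRealM_det γ
  have hc : toRealM γ 1 0 = 0 := by
    have := congrArg Complex.im h
    simpa [jFac, hz] using this
  have hd : toRealM γ 1 1 = 0 := by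
    have := congrArg Complex.re h
    simpa [jFac, hc] using this
  simp [hc, hd] at hdet

lemma jFac_conj (M : Matrix (Fin 2) (Fin 2) ℝ) (z : ℂ) :
    jFac M (conj z) = conj (jFac M z) := by
  simp [jFac]

lemma moeb_conj (M : Matrix (Fin 2) (Fin 2) ℝ) (z : ℂ) :
    moeb M (conj z) = conj (moeb M z) := by
  simp [moeb]

lemma moeb_sub_moeb (γ : SL2Z) {z w : ℂ} (hz : z.im ≠ 0) (hw : w.im ≠ 0) :
    moeb (toRealM γ) z - moeb (toRealM γ) w =
      (z - w) / (jFac (toRealM γ) z * jFac (toRealM γ) w) := by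
  have h1 := jFac_ne_zero γ hz
  have h2 := jFac_ne_zero γ hw
  unfold moeb
  unfold jFac at *
  rw [div_sub_div _ _ h1 h2]
  congr 1
  linear_combination (z - w) * toRealM_det γ

lemma im_moeb_ne_zero (γ : SL2Z) {z : ℂ} (hz : z.im ≠ 0) : (moeb (toRealM γ) z).im ≠ 0 := by
  have hz' : (conj z).im ≠ 0 := by simpa using hz
  rw [Ne, ← Complex.conj_eq_iff_im, eq_comm, ← moeb_conj, ← sub_eq_zero,
    moeb_sub_moeb γ hz hz', div_eq_zero_iff, not_or]
  refine ⟨?_, mul_ne_zero (jFac_ne_zero γ hz) (jFac_ne_zero γ hz')⟩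
  rwa [sub_eq_zero, eq_comm, Complex.conj_eq_iff_im]

/-- The cocycle relation for the automorphy factor. -/
lemma jFac_mul (γ δ : SL2Z) {z : ℂ} (hz : z.im ≠ 0) :
    jFac (toRealM (γ * δ)) z =
      jFac (toRealM γ) (moeb (toRealM δ) z) * jFac (toRealM δ) z := by
  have h := jFac_ne_zero δ hz
  rw [toRealM_mul]
  unfold moeb
  unfold jFac at *
  simp only [Matrix.mul_apply, Fin.sum_univ_two]
  push_cast
  field_simp
  ring

lemma moeb_mul (γ δ : SL2Z) {z : ℂ} (hz : z.im ≠ 0) :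
    moeb (toRealM (γ * δ)) z = moeb (toRealM γ) (moeb (toRealM δ) z) := by
  have h := jFac_ne_zero δ hz
  have h1 := jFac_ne_zero γ (im_moeb_ne_zero δ hz)
  have h2 := jFac_ne_zero (γ * δ) hz
  have h3 := jFac_mul γ δ hz
  change _ / jFac (toRealM (γ * δ)) z = _ / jFac (toRealM γ) (moeb (toRealM δ) z)
  rw [div_eq_div_iff h2 h1, h3, toRealM_mul]
  unfold moeb
  unfold jFac at *
  simp only [Matrix.mul_apply, Fin.sum_univ_two]
  push_cast
  field_simp
  ring

/-- Equivariance of `ψ^{p,q}` under the diagonal action of `SL₂(ℤ)`. -/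
lemma psiPQ_moeb (γ : SL2Z) (p q : ℤ) {z w : ℂ} (hz : z.im ≠ 0) (hw : w.im ≠ 0) :
    psiPQ p q (moeb (toRealM γ) z) (moeb (toRealM γ) w) =
      jFac (toRealM γ) z ^ (p + q + 2) * jFac (toRealM γ) w ^ p *
        jFac (toRealM γ) (conj w) ^ q * psiPQ p q z w := by
  have hw' : (conj w).im ≠ 0 := by simpa using hw
  have h1 := jFac_ne_zero γ hz
  have h2 := jFac_ne_zero γ hw
  have h3 := jFac_ne_zero γ hw'
  unfold psiPQ
  rw [← moeb_conj, moeb_sub_moeb γ hz hw, moeb_sub_moeb γ hz hw', moeb_sub_moeb γ hw hw',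
    show p + q + 2 = (p + 1) + (q + 1) by ring, zpow_add₀ h1]
  simp only [div_zpow, mul_zpow]
  rw [zpow_add_one₀ h2, zpow_add_one₀ h3]
  generalize (z - w) ^ (p + 1) = A
  generalize (z - conj w) ^ (q + 1) = B
  have := zpow_ne_zero (p + 1) h1
  have := zpow_ne_zero (q + 1) h1
  have := zpow_ne_zero p h2
  have := zpow_ne_zero q h3
  generalize jFac (toRealM γ) z ^ (p + 1) = a at *
  generalize jFac (toRealM γ) z ^ (q + 1) = b at *
  generalize jFac (toRealM γ) w ^ p = c at *
  generalize jFac (toRealM γ) (conj w) ^ q = d at *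
  rcases eq_or_ne A 0 with rfl | hA
  · simp
  rcases eq_or_ne B 0 with rfl | hB
  · simp
  field_simp

theorem statement_6
    (Γ : Subgroup SL2Z) (hΓ : Γ.FiniteIndex)
    (p q : ℤ) (hpq : 0 < p + q)
    (z w : ℂ) (hz : z.im ≠ 0) (hw : w.im ≠ 0)
    (h : ∀ γ : Γ, moeb (toRealM ↑γ) z ≠ w ∧ moeb (toRealM ↑γ) z ≠ conj w) :
    ∀ γ₁ γ₂ : Γ,
      PsiS Γ p q (moeb (toRealM ↑γ₁) z) (moeb (toRealM ↑γ₂) w) =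
        jFac (toRealM ↑γ₁) z ^ (p + q + 2) * jFac (toRealM ↑γ₂) w ^ p *
          jFac (toRealM ↑γ₂) (conj w) ^ q * PsiS Γ p q z w := by
  intro γ₁ γ₂
  unfold PsiS
  rw [← ((Equiv.mulLeft γ₂).trans (Equiv.mulRight γ₁⁻¹)).tsum_eq, ← tsum_mul_left]
  refine tsum_congr fun γ => ?_
  obtain ⟨δ, hδ⟩ : ∃ δ : SL2Z,
      δ = ↑(((Equiv.mulLeft γ₂).trans (Equiv.mulRight γ₁⁻¹)) γ) := ⟨_, rfl⟩
  have hmul : δ * (γ₁ : SL2Z) = γ₂ * γ := by simp [hδ]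
  have hγz := im_moeb_ne_zero (γ : SL2Z) hz
  have hj : jFac (toRealM δ) (moeb (toRealM ↑γ₁) z) * jFac (toRealM ↑γ₁) z =
      jFac (toRealM ↑γ₂) (moeb (toRealM ↑γ) z) * jFac (toRealM ↑γ) z := by
    rw [← jFac_mul _ _ hz, hmul, jFac_mul _ _ hz]
  have h1 := jFac_ne_zero (γ₁ : SL2Z) hz
  have h2 := jFac_ne_zero (γ₂ : SL2Z) hγz
  rw [← hδ, ← moeb_mul δ _ hz, hmul, moeb_mul _ _ hz, psiPQ_moeb _ p q hγz hw,
    eq_div_of_mul_eq h1 hj]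
  simp only [zpow_neg, div_zpow, mul_zpow]
  have := zpow_ne_zero (p + q + 2) h1
  have := zpow_ne_zero (p + q + 2) h2
  have := zpow_ne_zero (p + q + 2) (jFac_ne_zero (γ : SL2Z) hz)
  generalize jFac (toRealM ↑γ₁) z ^ (p + q + 2) = a at *
  generalize jFac (toRealM ↑γ₂) (moeb (toRealM ↑γ) z) ^ (p + q + 2) = b at *
  generalize jFac (toRealM ↑γ) z ^ (p + q + 2) = c at *
  field_simp
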